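/- For n ≥ 5 and m ≥ 0, as ρ → 0⁺: S_m(ρ) = 2^{-(n+m)}·[2(n+m-2)!/((n-2)! ρ^{n+m-1}) + 2(n-1)(n+m-3)!/((n-3)! ρ^{n+m-2}) + (n-1)(n-4/3)(n+m-4)!/((n-4)! ρ^{n+m-3}) + (1/3)(n-1)²(n-2)(n+m-5)!/((n-5)! ρ^{n+m-4})] + O(ρ^{-(n+m-5)}). -/

import Mathlib

/-- Closed form (recursive) of the series. -/
noncomputable def auxT : ℕ → ℕ → ℝ → ℝ
  | 0, k, r => 1 / (1 - r) ^ (k + 1)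
  | m + 1, k, r => ((k : ℝ) + 1) * (auxT m (k + 1) r - auxT m k r)

/-- Rising factorial. -/
noncomputable def auxP : ℕ → ℝ → ℝ
  | 0, _ => 1
  | m + 1, y => y * auxP m (y + 1)

theorem auxT_hasSum (m k : ℕ) (r : ℝ) (hr : ‖r‖ < 1) :
    HasSum (fun l : ℕ => ((l + k).choose k : ℝ) * (l : ℝ) ^ m * r ^ l) (auxT m k r) := by
  induction m generalizing k with
  | zero =>
    have h := (summable_choose_mul_geometric_of_norm_lt_one k hr).hasSum
    rw [tsum_choose_mul_geometric_of_norm_lt_one k hr] at h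
    simpa [auxT] using h
  | succ m ih =>
    have h := ((ih (k + 1)).sub (ih k)).mul_left ((k : ℝ) + 1)
    refine h.congr_fun ?_ |> id
    intro l
    have e : ((l + (k + 1)).choose (k + 1) : ℝ) * ((k : ℝ) + 1)
        = ((l : ℝ) + k + 1) * ((l + k).choose k : ℝ) := by
      have := Nat.add_one_mul_choose_eq (l + k) k
      have h2 : (((l + k + 1) * (l + k).choose k : ℕ) : ℝ)
        = (((l + k + 1).choose (k + 1) * (k + 1) : ℕ) : ℝ) := by exact_mod_cast this
      push_cast at h2
      rw [← add_assoc]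
      linarith
    linear_combination (-(l : ℝ) ^ m * r ^ l) * e

theorem auxP_succ (m : ℕ) (y : ℝ) : auxP (m + 1) y = auxP m y * (y + m) := by
  induction m generalizing y with
  | zero => simp [auxP]
  | succ m ih =>
    rw [auxP, ih (y + 1)]
    conv_rhs => rw [auxP]
    push_cast; ring

theorem auxP_fact (m j : ℕ) :
    auxP m ((j : ℝ) + 1) * (j.factorial : ℝ) = ((j + m).factorial : ℝ) := by
  induction m with
  | zero => simp [auxP]
  | succ m ih =>
    rw [auxP_succ, ← add_assoc, Nat.factorial_succ]
    push_cast
    rw [← ih]; ring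

open Asymptotics Filter in
theorem aux_base1 :
    (fun x : ℝ => x / (1 - Real.exp (-x)) - (1 + x / 2 + x ^ 2 / 12))
      =O[nhdsWithin 0 (Set.Ioi 0)] (fun x : ℝ => x ^ 4) := by
  apply IsBigO.of_bound 10
  have h1 : Set.Ioo (0 : ℝ) 1 ∈ nhdsWithin (0 : ℝ) (Set.Ioi 0) := Ioo_mem_nhdsGT one_pos
  filter_upwards [h1] with x hx
  obtain ⟨h0, h1⟩ := hx
  have hb := Real.exp_bound (x := -x) (n := 5) (by rw [abs_neg, abs_of_pos h0]; exact h1.le)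
    (by norm_num)
  rw [abs_neg, abs_of_pos h0] at hb
  simp only [Finset.sum_range_succ, Finset.sum_range_zero, Nat.factorial] at hb
  norm_num at hb
  obtain ⟨E, hE⟩ : ∃ E, E = Real.exp (-x) := ⟨_, rfl⟩
  rw [← hE] at hb ⊢
  obtain ⟨R, hR⟩ : ∃ R, R = E - (1 - x + x ^ 2 / 2 - x ^ 3 / 6 + x ^ 4 / 24) := ⟨_, rfl⟩
  have hR' : |R| ≤ x ^ 5 := by
    have : |R| ≤ x ^ 5 * (1 / 100) := by
      rw [hR]; convert hb using 2
      · ring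
    nlinarith [pow_pos h0 5]
  obtain ⟨hRl, hRu⟩ := abs_le.mp hR'
  have hR1 : R ≤ x ^ 5 * (1/100) := by
    have : |R| ≤ x ^ 5 * (1 / 100) := by
      rw [hR]; convert hb using 2
      · ring
    exact (le_abs_self R).trans this
  have p2 : x ^ 2 ≤ x := by nlinarith
  have p5 : x ^ 5 ≤ x := by
    calc x ^ 5 ≤ x ^ 1 := pow_le_pow_of_le_one h0.le h1.le (by norm_num)
      _ = x := pow_one x
  have p4 : x ^ 4 ≤ x ^ 3 := pow_le_pow_of_le_one h0.le h1.le (by norm_num)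
  have hD : x / 4 ≤ 1 - E := by
    have : E = R + (1 - x + x ^ 2 / 2 - x ^ 3 / 6 + x ^ 4 / 24) := by rw [hR]; ring
    nlinarith [pow_pos h0 3]
  have hDp : 0 < 1 - E := by linarith
  have key : x / (1 - E) - (1 + x / 2 + x ^ 2 / 12)
      = (R * (1 + x / 2 + x ^ 2 / 12) + x ^ 5 * (1 / 144 + x / 288)) / (1 - E) := by
    rw [hR]
    field_simp
    ring
  rw [key, Real.norm_eq_abs, Real.norm_eq_abs, abs_div, abs_of_pos hDp,
    abs_of_pos (pow_pos h0 4), div_le_iff₀ hDp]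
  have b1 : |R * (1 + x / 2 + x ^ 2 / 12)| ≤ x ^ 5 * 2 := by
    rw [abs_mul, abs_of_pos (by positivity : 0 < 1 + x / 2 + x ^ 2 / 12)]
    exact mul_le_mul hR' (by linarith) (by positivity) (by positivity)
  have b2 : |x ^ 5 * (1 / 144 + x / 288)| ≤ x ^ 5 * (1 / 2) := by
    rw [abs_of_pos (by positivity)]
    exact mul_le_mul_of_nonneg_left (by linarith) (by positivity)
  calc _ ≤ _ := abs_add_le _ _
    _ ≤ x ^ 5 * 2 + x ^ 5 * (1 / 2) := add_le_add b1 b2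
    _ = 10 * x ^ 4 * (x / 4) := by ring
    _ ≤ _ := mul_le_mul_of_nonneg_left hD (by positivity)

noncomputable def auxA (x N : ℝ) : ℝ :=
  1 + N / 2 * x + N * (3 * N - 1) / 24 * x ^ 2 + N ^ 2 * (N - 1) / 48 * x ^ 3

open Asymptotics Filter in
theorem aux_base (k : ℕ) :
    (fun x : ℝ => (x / (1 - Real.exp (-x))) ^ k - auxA x k)
      =O[nhdsWithin 0 (Set.Ioi 0)] (fun x : ℝ => x ^ 4) := by
  induction k with
  | zero => simpa [auxA] using isBigO_zero _ _
  | succ k ih =>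
    have hc : ∀ f : ℝ → ℝ, Continuous f →
        f =O[nhdsWithin 0 (Set.Ioi 0)] (fun _ : ℝ => (1 : ℝ)) := fun f hf =>
      ((hf.tendsto 0).mono_left nhdsWithin_le_nhds).isBigO_one ℝ
    have hx4 : (fun x : ℝ => x ^ 4) =O[nhdsWithin 0 (Set.Ioi 0)] (fun _ : ℝ => (1 : ℝ)) :=
      hc _ (by fun_prop)
    have hA := hc (fun x => auxA x k) (by unfold auxA; fun_prop)
    have hB := hc (fun x : ℝ => (1 + x / 2 + x ^ 2 / 12)) (by fun_prop)
    have t1 := ih.mul (hB.add (aux_base1.trans hx4))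
    have t2 := hA.mul aux_base1
    have t3 := (isBigO_refl (fun x : ℝ => x ^ 4) (nhdsWithin 0 (Set.Ioi 0))).mul
      (hc (fun x : ℝ => ((k : ℝ) ^ 2 * (k - 1) / 96 + k * (3 * k - 1) / 288 + k ^ 2 * (k - 1) / 576 * x))
        (by fun_prop))
    simp only [mul_one, one_mul] at t1 t2 t3
    refine ((t1.add t2).add t3).congr_left ?_
    intro x
    simp only [auxA]
    push_cast
    ring

noncomputable def auxB (m : ℕ) (x N : ℝ) : ℝ :=
  auxP m N + N / 2 * auxP m (N - 1) * x + N * (3 * N - 1) / 24 * auxP m (N - 2) * x ^ 2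
    + N ^ 2 * (N - 1) / 48 * auxP m (N - 3) * x ^ 3

open Asymptotics Filter in
theorem aux_main (m k : ℕ) :
    (fun x : ℝ => x ^ (k + 1 + m) * auxT m k (Real.exp (-x)) - auxB m x (k + 1))
      =O[nhdsWithin 0 (Set.Ioi 0)] (fun x : ℝ => x ^ 4) := by
  induction m generalizing k with
  | zero =>
    refine (aux_base (k + 1)).congr_left ?_
    intro x
    simp [auxA, auxB, auxT, auxP, div_pow]
    ring
  | succ m ih =>
    have hx : (fun x : ℝ => x) =O[nhdsWithin 0 (Set.Ioi 0)] (fun _ : ℝ => (1 : ℝ)) :=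
      ((continuous_id.tendsto 0).mono_left nhdsWithin_le_nhds).isBigO_one ℝ
    have hr : (fun x : ℝ => x ^ 4) =O[nhdsWithin 0 (Set.Ioi 0)] (fun x : ℝ => x ^ 4) :=
      isBigO_refl _ _
    have t2 := hx.mul (ih k)
    simp only [one_mul] at t2
    have t := (((ih (k + 1)).sub t2).const_mul_left ((k : ℝ) + 1)).sub
      (hr.const_mul_left (((k : ℝ) + 1) ^ 3 * k / 48 * auxP m (k + 1 - 3)))
    refine t.congr_left ?_
    intro x
    simp only [auxB, auxT]
    push_cast
    have e0 : auxP (m + 1) ((k : ℝ) + 1) = (k + 1) * auxP m (k + 1 + 1) := rfl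
    have e1 : auxP (m + 1) ((k : ℝ) + 1 - 1) = k * auxP m (k + 1) := by
      rw [auxP]; ring_nf
    have e2 : auxP (m + 1) ((k : ℝ) + 1 - 2) = (k - 1) * auxP m k := by
      rw [auxP]; ring_nf
    have e3 : auxP (m + 1) ((k : ℝ) + 1 - 3) = (k - 2) * auxP m (k - 1) := by
      rw [auxP]; ring_nf
    rw [e0, e1, e2, e3, show (k : ℝ) + 1 + 1 - 1 = k + 1 by ring,
      show (k : ℝ) + 1 + 1 - 2 = k by ring, show (k : ℝ) + 1 + 1 - 3 = k - 1 by ring,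
      show (k : ℝ) + 1 - 1 = k by ring, show (k : ℝ) + 1 - 2 = k - 1 by ring]
    ring

open Asymptotics in
theorem stmt_7 (n m : ℕ) (hn : 5 ≤ n) :
    (fun ρ : ℝ => ρ ^ (n + m - 1) *
        ((∑' l : ℕ, (Nat.choose (l + n - 2) l : ℝ) * (l : ℝ) ^ m * Real.exp (-2 * ρ * l)) -
          (2 : ℝ) ^ (-((n : ℤ) + m)) *
            (2 * (Nat.factorial (n + m - 2) : ℝ) / ((Nat.factorial (n - 2) : ℝ) * ρ ^ (n + m - 1)) +
             2 * ((n : ℝ) - 1) * (Nat.factorial (n + m - 3) : ℝ) /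
               ((Nat.factorial (n - 3) : ℝ) * ρ ^ (n + m - 2)) +
             ((n : ℝ) - 1) * ((n : ℝ) - 4 / 3) * (Nat.factorial (n + m - 4) : ℝ) /
               ((Nat.factorial (n - 4) : ℝ) * ρ ^ (n + m - 3)) +
             (1 / 3) * ((n : ℝ) - 1) ^ 2 * ((n : ℝ) - 2) * (Nat.factorial (n + m - 5) : ℝ) /
               ((Nat.factorial (n - 5) : ℝ) * ρ ^ (n + m - 4)))))
      =O[nhdsWithin 0 (Set.Ioi 0)] (fun ρ : ℝ => ρ ^ 4) := by
  obtain ⟨q, rfl⟩ := Nat.exists_eq_add_of_le' hn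
  have ht : Filter.Tendsto (fun ρ : ℝ => 2 * ρ) (nhdsWithin 0 (Set.Ioi 0))
      (nhdsWithin 0 (Set.Ioi 0)) := by
    apply tendsto_nhdsWithin_of_tendsto_nhds_of_eventually_within
    · have : Continuous (fun ρ : ℝ => 2 * ρ) := by fun_prop
      simpa using (this.tendsto 0).mono_left nhdsWithin_le_nhds
    · filter_upwards [self_mem_nhdsWithin] with x hx
      have : 0 < x := hx
      show 0 < 2 * x
      linarith
  have h := (aux_main m (q + 3)).comp_tendsto ht
  have h2 : ((fun x : ℝ => x ^ 4) ∘ fun ρ : ℝ => 2 * ρ)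
      =O[nhdsWithin 0 (Set.Ioi 0)] (fun ρ : ℝ => ρ ^ 4) := by
    apply IsBigO.of_bound 16
    filter_upwards with x
    simp [mul_pow]
    norm_num
  have h3 := (h.trans h2).const_mul_left ((2 : ℝ) ^ (q + m + 4))⁻¹
  refine h3.congr' ?_ (Filter.EventuallyEq.refl _ _)
  filter_upwards [self_mem_nhdsWithin] with ρ hρ
  have hρ0 : 0 < ρ := hρ
  have hr : ‖Real.exp (-(2 * ρ))‖ < 1 := by
    rw [Real.norm_eq_abs, abs_of_pos (Real.exp_pos _)]
    exact Real.exp_lt_one_iff.mpr (by linarith)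
  have hs : (∑' l : ℕ, (Nat.choose (l + (q + 5) - 2) l : ℝ) * (l : ℝ) ^ m
      * Real.exp (-2 * ρ * l)) = auxT m (q + 3) (Real.exp (-(2 * ρ))) := by
    rw [← (auxT_hasSum m (q + 3) _ hr).tsum_eq]
    congr 1
    funext l
    rw [← Real.exp_nat_mul, show l + (q + 5) - 2 = l + (q + 3) by omega, Nat.choose_symm_add]
    congr 2
    ring
  rw [hs]
  have f1 : q + 5 + m - 1 = q + m + 4 := by omega
  have f2 : q + 5 + m - 2 = q + m + 3 := by omega
  have f3 : q + 5 + m - 3 = q + m + 2 := by omega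
  have f4 : q + 5 + m - 4 = q + m + 1 := by omega
  have f5 : q + 5 + m - 5 = q + m := by omega
  rw [f1, f2, f3, f4, f5, show q + 5 - 2 = q + 3 by omega, show q + 5 - 3 = q + 2 by omega,
    show q + 5 - 4 = q + 1 by omega, show q + 5 - 5 = q by omega]
  have g0 := auxP_fact m (q + 3)
  have g1 := auxP_fact m (q + 2)
  have g2 := auxP_fact m (q + 1)
  have g3 := auxP_fact m q
  rw [show q + 3 + m = q + m + 3 by ring] at g0
  rw [show q + 2 + m = q + m + 2 by ring] at g1
  rw [show q + 1 + m = q + m + 1 by ring] at g2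
  rw [← g0, ← g1, ← g2, ← g3]
  have n0 : ((q + 3).factorial : ℝ) ≠ 0 := by positivity
  have n1 : ((q + 2).factorial : ℝ) ≠ 0 := by positivity
  have n2 : ((q + 1).factorial : ℝ) ≠ 0 := by positivity
  have n3 : (q.factorial : ℝ) ≠ 0 := by positivity
  have hz : (2 : ℝ) ^ (-(((q + 5 : ℕ) : ℤ) + m)) = ((2 : ℝ) ^ (q + m + 4))⁻¹ / 2 := by
    rw [zpow_neg, show (((q + 5 : ℕ) : ℤ) + m) = ((q + m + 5 : ℕ) : ℤ) by push_cast; ring,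
      zpow_natCast, pow_succ (2 : ℝ) (q + m + 4), mul_inv]
    rfl
  rw [hz]
  simp only [Function.comp, auxB]
  push_cast
  rw [show (q : ℝ) + 3 + 1 - 1 = q + 2 + 1 by ring, show (q : ℝ) + 3 + 1 - 2 = q + 1 + 1 by ring,
    show (q : ℝ) + 3 + 1 - 3 = q + 1 by ring, show q + 3 + 1 + m = q + m + 4 by ring]
  generalize auxT m (q + 3) (Real.exp (-(2 * ρ))) = T
  generalize auxP m ((q : ℝ) + 3 + 1) = P0
  generalize auxP m ((q : ℝ) + 2 + 1) = P1
  generalize auxP m ((q : ℝ) + 1 + 1) = P2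
  generalize auxP m ((q : ℝ) + 1) = P3
  rw [mul_pow]
  have n2 : (2 : ℝ) ^ (q + m) ≠ 0 := by positivity
  have n4 : ρ ^ (q + m) ≠ 0 := by positivity
  simp only [pow_add]
  field_simp
  ring
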